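/- arXiv:1401.3622 — 2 statements merged into one kernel-verified Lean document; each statement's English description precedes it below -/
import Mathlib

section
/- Comparison principle on the torus: let f : ℝ → ℝ be continuously differentiable and T > 0. Suppose ρ, σ : [0,T] × ℝ → ℝ are bounded, continuous, 1-periodic in the space variable, possess continuous derivatives ∂_t ρ, ∂_{uu} ρ, ∂_t σ, ∂_{uu} σ on (0,T] × ℝ, and satisfy there ∂_t ρ ≤ ∂_{uu} ρ + f(ρ) (subsolution) and ∂_t σ ≥ ∂_{uu} σ + f(σ) (supersolution). If ρ(0,u) ≤ σ(0,u) for all u ∈ ℝ, then ρ(t,u) ≤ σ(t,u) for all (t,u) ∈ [0,T] × ℝ. -/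
open Set

/-- `ρ` is bounded and continuous on `[0,T] × ℝ`, 1-periodic in the space variable,
and its time derivative and second space derivative exist and are continuous
on `(0,T] × ℝ`: the regularity required of sub- and supersolutions of the
semilinear heat equation on the torus. -/
def IsRegularPeriodic (T : ℝ) (ρ : ℝ → ℝ → ℝ) : Prop :=
  (∃ M : ℝ, ∀ t ∈ Set.Icc (0:ℝ) T, ∀ u : ℝ, |ρ t u| ≤ M)
  ∧ ContinuousOn (fun p : ℝ × ℝ => ρ p.1 p.2) (Set.Icc 0 T ×ˢ Set.univ)
  ∧ (∀ t ∈ Set.Icc (0:ℝ) T, ∀ u : ℝ, ρ t (u + 1) = ρ t u)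
  ∧ (∀ t ∈ Set.Ioc (0:ℝ) T, ∀ u : ℝ,
      DifferentiableAt ℝ (fun s => ρ s u) t
      ∧ DifferentiableAt ℝ (fun v => ρ t v) u
      ∧ DifferentiableAt ℝ (deriv (fun v => ρ t v)) u)
  ∧ ContinuousOn (fun p : ℝ × ℝ => deriv (fun s => ρ s p.2) p.1)
      (Set.Ioc 0 T ×ˢ Set.univ)
  ∧ ContinuousOn (fun p : ℝ × ℝ => deriv (deriv (fun v => ρ p.1 v)) p.2)
      (Set.Ioc 0 T ×ˢ Set.univ)

/-- Second-order necessary condition: the second derivative is nonpositive at a local maximum. -/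
theorem IsLocalMax.deriv_deriv_nonpos {g : ℝ → ℝ} {x : ℝ} (h : IsLocalMax g x)
    (hg : ContinuousAt g x) : deriv (deriv g) x ≤ 0 := by
  by_contra! hpos
  have hmin : IsLocalMin g x := isLocalMin_of_deriv_deriv_pos hpos h.deriv_eq_zero hg
  have hconst : g =ᶠ[nhds x] fun _ => g x := by
    filter_upwards [h, hmin] with y h₁ h₂ using le_antisymm h₁ h₂
  have hzero : deriv (deriv g) x = 0 := by
    rw [hconst.deriv.deriv_eq]
    simp
  exact hpos.ne' hzero

/-- The derivative is nonnegative at a point where a left-sided maximum is attained. -/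
theorem HasDerivAt.nonneg_of_forall_mem_Ioo_le {h : ℝ → ℝ} {h' a t : ℝ} (hd : HasDerivAt h h' t)
    (hat : a < t) (hle : ∀ s ∈ Set.Ioo a t, h s ≤ h t) : 0 ≤ h' := by
  have hlim := (hasDerivWithinAt_iff_tendsto_slope' (by simp)).1
    (hd.hasDerivWithinAt (s := Set.Iio t))
  refine ge_of_tendsto hlim ?_
  filter_upwards [Ioo_mem_nhdsLT hat] with s hs
  rw [slope_def_field]
  exact div_nonneg_of_nonpos (sub_nonpos.2 (hle s hs)) (sub_nonpos.2 hs.2.le)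

/-- A continuously differentiable function satisfies a one-sided Lipschitz bound on bounded
intervals. -/
theorem ContDiff.exists_sub_le_mul_sub {f : ℝ → ℝ} (hf : ContDiff ℝ 1 f) (a b : ℝ) :
    ∃ L : ℝ, ∀ x ∈ Set.Icc a b, ∀ y ∈ Set.Icc a b, x ≤ y → f y - f x ≤ L * (y - x) := by
  obtain ⟨L, hL⟩ := (isCompact_Icc (a := a) (b := b)).exists_bound_of_continuousOn
    (hf.continuous_deriv le_rfl).continuousOn
  refine ⟨L, fun x hx y hy hxy => ?_⟩
  have h := (convex_Icc a b).norm_image_sub_le_of_norm_deriv_le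
    (fun z _ => (hf.differentiable one_ne_zero) z) hL hx hy
  rw [Real.norm_eq_abs, Real.norm_eq_abs, abs_of_nonneg (sub_nonneg.2 hxy)] at h
  exact (le_abs_self _).trans h

/-- A continuous function on `[0,T] × ℝ` that is 1-periodic in space attains its maximum. -/
theorem exists_forall_le_of_periodic {T : ℝ} (hT : 0 ≤ T) {w : ℝ → ℝ → ℝ}
    (hcont : ContinuousOn (fun p : ℝ × ℝ => w p.1 p.2) (Set.Icc 0 T ×ˢ Set.univ))
    (hper : ∀ t ∈ Set.Icc (0:ℝ) T, ∀ u : ℝ, w t (u + 1) = w t u) :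
    ∃ t₀ ∈ Set.Icc (0:ℝ) T, ∃ u₀ : ℝ, ∀ t ∈ Set.Icc (0:ℝ) T, ∀ u : ℝ, w t u ≤ w t₀ u₀ := by
  obtain ⟨⟨t₀, u₀⟩, hmem, hmax⟩ :=
    ((isCompact_Icc (a := (0:ℝ)) (b := T)).prod (isCompact_Icc (a := (0:ℝ)) (b := 1))).exists_isMaxOn
      ⟨(0, 0), by simp [hT]⟩ (hcont.mono (Set.prod_mono_right (Set.subset_univ _)))
  refine ⟨t₀, hmem.1, u₀, fun t ht u => ?_⟩
  obtain ⟨v, hv, huv⟩ := Function.Periodic.exists_mem_Ico₀ (hper t ht) one_pos u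
  rw [huv]
  exact hmax (a := (t, v)) ⟨ht, Set.Ico_subset_Icc_self hv⟩

/-- Comparison principle on the torus: a subsolution of `∂ₜ ρ = ∂ᵤᵤ ρ + f(ρ)` that
starts below a supersolution stays below it for all times in `[0,T]`. -/
theorem semilinear_heat_comparison_principle
    (f : ℝ → ℝ) (hf : ContDiff ℝ 1 f)
    (T : ℝ) (hT : 0 < T)
    (ρ σ : ℝ → ℝ → ℝ)
    (hρreg : IsRegularPeriodic T ρ) (hσreg : IsRegularPeriodic T σ)
    (hsub : ∀ t ∈ Set.Ioc (0:ℝ) T, ∀ u : ℝ,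
        deriv (fun s => ρ s u) t
          ≤ deriv (deriv (fun v => ρ t v)) u + f (ρ t u))
    (hsup : ∀ t ∈ Set.Ioc (0:ℝ) T, ∀ u : ℝ,
        deriv (deriv (fun v => σ t v)) u + f (σ t u)
          ≤ deriv (fun s => σ s u) t)
    (hinit : ∀ u : ℝ, ρ 0 u ≤ σ 0 u) :
    ∀ t ∈ Set.Icc (0:ℝ) T, ∀ u : ℝ, ρ t u ≤ σ t u := by
  obtain ⟨⟨M, hM⟩, hρc, hρp, hρd, -, -⟩ := hρreg
  obtain ⟨⟨N, hN⟩, hσc, hσp, hσd, -, -⟩ := hσreg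
  obtain ⟨L, hL⟩ := hf.exists_sub_le_mul_sub (-max M N) (max M N)
  obtain ⟨t, ht, u, hmax⟩ := exists_forall_le_of_periodic hT.le
    (w := fun t u => Real.exp (-(L + 1) * t) * (ρ t u - σ t u))
    ((by fun_prop : Continuous fun p : ℝ × ℝ => Real.exp (-(L + 1) * p.1)).continuousOn.mul
      (hρc.sub hσc))
    (fun t ht u => by simp only [hρp t ht u, hσp t ht u])
  suffices hle : ρ t u ≤ σ t u by
    intro s hs v
    have h := (hmax s hs v).trans
      (mul_nonpos_of_nonneg_of_nonpos (Real.exp_pos _).le (sub_nonpos.2 hle))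
    exact sub_nonpos.1 (nonpos_of_mul_nonpos_right h (Real.exp_pos _))
  by_contra! hlt
  have ht0 : 0 < t := ht.1.lt_of_ne fun h => (hinit u).not_gt (by rwa [← h] at hlt)
  have htI : t ∈ Set.Ioc 0 T := ⟨ht0, ht.2⟩
  have hspace : deriv (deriv fun v => ρ t v) u - deriv (deriv fun v => σ t v) u ≤ 0 := by
    have hfun : deriv (fun v => ρ t v - σ t v)
        = fun v => deriv (fun v => ρ t v) v - deriv (fun v => σ t v) v :=
      funext fun v => deriv_fun_sub (hρd t htI v).2.1 (hσd t htI v).2.1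
    have hloc : IsLocalMax (fun v => ρ t v - σ t v) u :=
      Filter.Eventually.of_forall fun v =>
        le_of_mul_le_mul_left (hmax t ht v) (Real.exp_pos _)
    have h := hloc.deriv_deriv_nonpos
      ((hρd t htI u).2.1.sub (hσd t htI u).2.1).continuousAt
    rwa [hfun, deriv_fun_sub (hρd t htI u).2.2 (hσd t htI u).2.2] at h
  have htime : (L + 1) * (ρ t u - σ t u)
      ≤ deriv (fun s => ρ s u) t - deriv (fun s => σ s u) t := by
    have hexp : HasDerivAt (fun s => Real.exp (-(L + 1) * s))
        (Real.exp (-(L + 1) * t) * (-(L + 1))) t := by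
      simpa using ((hasDerivAt_id t).const_mul (-(L + 1))).exp
    have h := (hexp.mul ((hρd t htI u).1.hasDerivAt.sub
      (hσd t htI u).1.hasDerivAt)).nonneg_of_forall_mem_Ioo_le ht0
      fun s hs => hmax s ⟨hs.1.le, hs.2.le.trans ht.2⟩ u
    simp only [Pi.sub_apply, mul_assoc, ← mul_add] at h
    have := nonneg_of_mul_nonneg_right h (Real.exp_pos _)
    linarith
  have hlip := hL (σ t u)
    (abs_le.1 ((hN t ht u).trans (le_max_right M N))) (ρ t u)
    (abs_le.1 ((hM t ht u).trans (le_max_left M N))) hlt.le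
  linarith [hsub t htI u, hsup t htI u]
end

section
/- Continuation criterion (finiteness of the sup-norm prevents blow-up): let f : ℝ → ℝ be continuously differentiable, φ : ℝ → ℝ continuous and 1-periodic, and let ρ be a classical solution on [0,T) of ∂_t ρ = ∂_{uu} ρ + f(ρ) with initial condition φ, where 0 < T < ∞. If sup_{0 ≤ t < T} sup_{u ∈ ℝ} |ρ(t,u)| < ∞, then there exist T' > T and a classical solution ρ' on [0,T') of the same equation with ρ'(t,u) = ρ(t,u) for all t ∈ [0,T) and u ∈ ℝ. Consequently, a maximal solution with finite maximal time T_blow-up satisfies lim_{t↗T_blow-up} ‖ρ(t,·)‖_∞ = ∞. -/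
open Set

/-- `ρ : ℝ → ℝ → ℝ` (time, space) is a classical solution on the half-open interval
`[0,T)` of the periodic semilinear heat equation `∂ₜ ρ = ∂ᵤᵤ ρ + f(ρ)` with initial
condition `φ`: continuous on `[0,T) × ℝ`, 1-periodic in space, equal to `φ` at time
`0`, with time derivative and second space derivative existing and continuous on
`(0,T) × ℝ`, where the equation holds. -/
def IsSemilinearHeatSolutionIco (T : ℝ) (f : ℝ → ℝ) (φ : ℝ → ℝ)
    (ρ : ℝ → ℝ → ℝ) : Prop :=
  ContinuousOn (fun p : ℝ × ℝ => ρ p.1 p.2) (Set.Ico 0 T ×ˢ Set.univ)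
  ∧ (∀ t ∈ Set.Ico (0:ℝ) T, ∀ u : ℝ, ρ t (u + 1) = ρ t u)
  ∧ (∀ u : ℝ, ρ 0 u = φ u)
  ∧ (∀ t ∈ Set.Ioo (0:ℝ) T, ∀ u : ℝ,
      DifferentiableAt ℝ (fun s => ρ s u) t
      ∧ DifferentiableAt ℝ (fun v => ρ t v) u
      ∧ DifferentiableAt ℝ (deriv (fun v => ρ t v)) u
      ∧ deriv (fun s => ρ s u) t
          = deriv (deriv (fun v => ρ t v)) u + f (ρ t u))
  ∧ ContinuousOn (fun p : ℝ × ℝ => deriv (fun s => ρ s p.2) p.1)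
      (Set.Ioo 0 T ×ˢ Set.univ)
  ∧ ContinuousOn (fun p : ℝ × ℝ => deriv (deriv (fun v => ρ p.1 v)) p.2)
      (Set.Ioo 0 T ×ˢ Set.univ)

open MeasureTheory ProbabilityTheory Topology Filter

/-- The average of `h` over the Gaussian law with mean `u` and standard deviation `|y|`;
with `y = √(2t)` this is the heat semigroup at time `t`. -/
noncomputable def heatAvg (h : ℝ → ℝ) (y u : ℝ) : ℝ :=
  ∫ z, h (u + y * z) ∂(gaussianReal 0 1)

/-- The first moment of `z ↦ h (u + y * z)` under the standard Gaussian law. -/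
noncomputable def heatMoment (h : ℝ → ℝ) (y u : ℝ) : ℝ :=
  ∫ z, z * h (u + y * z) ∂(gaussianReal 0 1)

/-- The first absolute moment of the standard Gaussian law. -/
noncomputable def gaussAbsMoment : ℝ := ∫ z, |z| ∂(gaussianReal 0 1)

lemma integrable_id_gaussian : Integrable (fun z : ℝ => z) (gaussianReal 0 1) :=
  (memLp_id_gaussianReal (μ := 0) (v := 1) 1).integrable (by simp)

lemma gaussAbsMoment_nonneg : 0 ≤ gaussAbsMoment :=
  integral_nonneg fun z => abs_nonneg z

lemma continuous_gaussian_integral {X : Type*} [TopologicalSpace X] [FirstCountableTopology X]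
    {k : X → ℝ → ℝ} (hk : Continuous (Function.uncurry k)) {C : ℝ} (hC : ∀ x z, |k x z| ≤ C) :
    Continuous fun x => ∫ z, k x z ∂(gaussianReal 0 1) := by
  refine continuous_of_dominated (bound := fun _ => C) (fun x => ?_) (fun x => ?_) ?_ ?_
  · exact (hk.comp (Continuous.prodMk_right x)).aestronglyMeasurable
  · exact Eventually.of_forall fun z => hC x z
  · exact integrable_const C
  · exact Eventually.of_forall fun z => hk.comp (Continuous.prodMk_left z)

lemma continuous_gaussian_moment {X : Type*} [TopologicalSpace X] [FirstCountableTopology X]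
    {k : X → ℝ → ℝ} (hk : Continuous (Function.uncurry k)) {C : ℝ} (hC : ∀ x z, |k x z| ≤ C) :
    Continuous fun x => ∫ z, z * k x z ∂(gaussianReal 0 1) := by
  refine continuous_of_dominated (bound := fun z => |z| * C) (fun x => ?_) (fun x => ?_) ?_ ?_
  · exact (continuous_id.mul (hk.comp (Continuous.prodMk_right x))).aestronglyMeasurable
  · refine Eventually.of_forall fun z => ?_
    rw [Real.norm_eq_abs, abs_mul]
    exact mul_le_mul_of_nonneg_left (hC x z) (abs_nonneg z)
  · exact integrable_id_gaussian.abs.mul_const C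
  · exact Eventually.of_forall fun z =>
      continuous_const.mul (hk.comp (Continuous.prodMk_left z))

section Averages

variable {h h' : ℝ → ℝ} {C C' : ℝ}

lemma integrable_heatAvg (hc : Continuous h) (hC : ∀ x, |h x| ≤ C) (y u : ℝ) :
    Integrable (fun z => h (u + y * z)) (gaussianReal 0 1) :=
  (integrable_const C).mono' (by fun_prop) (Eventually.of_forall fun z => hC _)

lemma abs_heatAvg_le (hC : ∀ x, |h x| ≤ C) (y u : ℝ) : |heatAvg h y u| ≤ C := by
  have := norm_integral_le_of_norm_le_const (μ := gaussianReal 0 1)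
    (f := fun z => h (u + y * z)) (C := C) (Eventually.of_forall fun z => hC _)
  simpa [heatAvg] using this

lemma abs_heatMoment_le (hC : ∀ x, |h x| ≤ C) (y u : ℝ) :
    |heatMoment h y u| ≤ gaussAbsMoment * C := by
  have := norm_integral_le_of_norm_le (μ := gaussianReal 0 1)
    (f := fun z => z * h (u + y * z)) (integrable_id_gaussian.abs.mul_const C)
    (Eventually.of_forall fun z => by
      rw [Real.norm_eq_abs, abs_mul]
      exact mul_le_mul_of_nonneg_left (hC _) (abs_nonneg z))
  rwa [integral_mul_const] at this

lemma heatAvg_zero (h : ℝ → ℝ) (u : ℝ) : heatAvg h 0 u = h u := by simp [heatAvg]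

lemma heatMoment_zero (h : ℝ → ℝ) (u : ℝ) : heatMoment h 0 u = 0 := by
  simp [heatMoment, integral_mul_const, integral_id_gaussianReal]

lemma heatAvg_sub {k : ℝ → ℝ} {D : ℝ} (hc : Continuous h) (hC : ∀ x, |h x| ≤ C)
    (kc : Continuous k) (kD : ∀ x, |k x| ≤ D) (y u : ℝ) :
    heatAvg (fun x => h x - k x) y u = heatAvg h y u - heatAvg k y u :=
  integral_sub (integrable_heatAvg hc hC y u) (integrable_heatAvg kc kD y u)

lemma heatAvg_add_one (hp : ∀ u, h (u + 1) = h u) (y u : ℝ) :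
    heatAvg h y (u + 1) = heatAvg h y u := by
  unfold heatAvg
  congr 1
  ext z
  rw [← hp (u + y * z)]
  ring_nf

lemma hasDerivAt_heatAvg_space (hd : ∀ x, HasDerivAt h (h' x) x) (hc' : Continuous h')
    (hC : ∀ x, |h x| ≤ C) (hC' : ∀ x, |h' x| ≤ C') (y u : ℝ) :
    HasDerivAt (fun v => heatAvg h y v) (heatAvg h' y u) u := by
  have hc : Continuous h := continuous_iff_continuousAt.2 fun x => (hd x).continuousAt
  refine (hasDerivAt_integral_of_dominated_loc_of_deriv_le (bound := fun _ => C')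
    (F' := fun v z => h' (v + y * z)) univ_mem
    (Eventually.of_forall fun v => by fun_prop) (integrable_heatAvg hc hC y u) (by fun_prop)
    (Eventually.of_forall fun z v _ => hC' _) (integrable_const _)
    (Eventually.of_forall fun z v _ => ?_)).2
  exact (hd (v + y * z)).comp_add_const v (y * z)

lemma hasDerivAt_heatAvg_scale (hd : ∀ x, HasDerivAt h (h' x) x) (hc' : Continuous h')
    (hC : ∀ x, |h x| ≤ C) (hC' : ∀ x, |h' x| ≤ C') (y u : ℝ) :
    HasDerivAt (fun s => heatAvg h s u) (heatMoment h' y u) y := by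
  have hc : Continuous h := continuous_iff_continuousAt.2 fun x => (hd x).continuousAt
  refine (hasDerivAt_integral_of_dominated_loc_of_deriv_le (bound := fun z => |z| * C')
    (F' := fun s z => z * h' (u + s * z)) univ_mem
    (Eventually.of_forall fun v => by fun_prop) (integrable_heatAvg hc hC y u) (by fun_prop)
    (Eventually.of_forall fun z v _ => ?_) (integrable_id_gaussian.abs.mul_const C')
    (Eventually.of_forall fun z s _ => ?_)).2
  · rw [Real.norm_eq_abs, abs_mul]
    exact mul_le_mul_of_nonneg_left (hC' _) (abs_nonneg z)
  · have h1 : HasDerivAt (fun s : ℝ => u + s * z) z s := by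
      simpa using ((hasDerivAt_id s).mul_const z).const_add u
    exact ((hd (u + s * z)).comp s h1).congr_deriv (mul_comm _ _)

lemma gaussianPDFReal_zero_one (z : ℝ) :
    gaussianPDFReal 0 1 z = (√(2 * Real.pi))⁻¹ * Real.exp (-(1 / 2) * z ^ 2) := by
  simp only [gaussianPDFReal_def]
  norm_num
  left
  ring

lemma hasDerivAt_gaussianPDFReal_shift (z a : ℝ) :
    HasDerivAt (fun s => gaussianPDFReal 0 1 (z - s)) ((z - a) * gaussianPDFReal 0 1 (z - a)) a := by
  simp only [gaussianPDFReal_zero_one]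
  have h1 : HasDerivAt (fun s : ℝ => -(1 / 2) * (z - s) ^ 2) (z - a) a := by
    refine ((((hasDerivAt_id a).const_sub z).pow 2).const_mul (-(1 / 2) : ℝ)).congr_deriv ?_
    simp
  exact (h1.exp.const_mul (√(2 * Real.pi))⁻¹).congr_deriv (by ring)

lemma abs_mul_gaussianPDFReal_shift_le (z a : ℝ) (ha : |a| ≤ 1) :
    |(z - a) * gaussianPDFReal 0 1 (z - a)| ≤
      (√(2 * Real.pi))⁻¹ * Real.exp (1 / 2) * ((|z| + 1) * Real.exp (-(1 / 4) * z ^ 2)) := by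
  rw [gaussianPDFReal_zero_one, abs_mul, abs_mul, abs_of_nonneg (Real.exp_nonneg _),
    abs_of_nonneg (by positivity : 0 ≤ (√(2 * Real.pi))⁻¹)]
  have h1 : |z - a| ≤ |z| + 1 := (abs_sub z a).trans (by linarith)
  have h2 : Real.exp (-(1 / 2) * (z - a) ^ 2) ≤ Real.exp (1 / 2) * Real.exp (-(1 / 4) * z ^ 2) := by
    rw [← Real.exp_add, Real.exp_le_exp]
    have : a ^ 2 ≤ 1 := by rw [← sq_abs]; nlinarith [abs_nonneg a]
    nlinarith [sq_nonneg (z - 2 * a)]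
  calc |z - a| * ((√(2 * Real.pi))⁻¹ * Real.exp (-(1 / 2) * (z - a) ^ 2))
      ≤ (|z| + 1) * ((√(2 * Real.pi))⁻¹ * (Real.exp (1 / 2) * Real.exp (-(1 / 4) * z ^ 2))) := by
        gcongr
    _ = _ := by ring

lemma hasDerivAt_gaussianPDFReal_convolution {k : ℝ → ℝ} (kc : Continuous k)
    (kC : ∀ x, |k x| ≤ C) :
    HasDerivAt (fun s => ∫ z, gaussianPDFReal 0 1 (z - s) * k z)
      (∫ z, z * gaussianPDFReal 0 1 z * k z) 0 := by
  have hg : Continuous (gaussianPDFReal 0 1) := by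
    simp only [funext gaussianPDFReal_zero_one]
    fun_prop
  have key := hasDerivAt_integral_of_dominated_loc_of_deriv_le (μ := volume) (x₀ := (0 : ℝ))
    (F := fun s z => gaussianPDFReal 0 1 (z - s) * k z)
    (F' := fun s z => (z - s) * gaussianPDFReal 0 1 (z - s) * k z)
    (bound := fun z => (√(2 * Real.pi))⁻¹ * Real.exp (1 / 2) *
      ((|z| + 1) * Real.exp (-(1 / 4) * z ^ 2)) * C)
    (Metric.closedBall_mem_nhds (0 : ℝ) one_pos)
    (Eventually.of_forall fun v => (by fun_prop : Continuous _).aestronglyMeasurable) ?_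
    (by fun_prop : Continuous _).aestronglyMeasurable ?_ ?_ ?_
  · simpa using key.2
  · simp only [sub_zero]
    exact (integrable_gaussianPDFReal 0 1).mul_bdd (c := C) kc.aestronglyMeasurable
      (Eventually.of_forall kC)
  · refine Eventually.of_forall fun z s hs => ?_
    rw [norm_mul]
    refine mul_le_mul (abs_mul_gaussianPDFReal_shift_le z s ?_) (kC z) (norm_nonneg _) (by positivity)
    simpa using hs
  · refine (Integrable.const_mul ?_ _).mul_const _
    simp only [add_mul, one_mul]
    refine Integrable.add ?_ (integrable_exp_neg_mul_sq (by norm_num))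
    have := (integrable_mul_exp_neg_mul_sq (b := 1 / 4) (by norm_num)).abs
    refine this.congr (Eventually.of_forall fun z => ?_)
    simp [abs_mul]
  · exact Eventually.of_forall fun z s _ => (hasDerivAt_gaussianPDFReal_shift z s).mul_const _

lemma heatAvg_eq_integral (h : ℝ → ℝ) (y u : ℝ) :
    heatAvg h y u = ∫ z, gaussianPDFReal 0 1 z * h (u + y * z) := by
  simp [heatAvg, integral_gaussianReal_eq_integral_smul]

/-- Smoothing: the Gaussian average of a merely continuous function is differentiable. -/
lemma hasDerivAt_mul_heatAvg (hc : Continuous h) (hC : ∀ x, |h x| ≤ C) (y u : ℝ) :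
    HasDerivAt (fun v => y * heatAvg h y v) (heatMoment h y u) u := by
  rcases eq_or_ne y 0 with rfl | hy
  · simpa [heatMoment_zero] using hasDerivAt_const u (0 : ℝ)
  have key := hasDerivAt_gaussianPDFReal_convolution (k := fun z => h (u + y * z))
    (by fun_prop) (fun x => hC _)
  have hm : (∫ z, z * gaussianPDFReal 0 1 z * h (u + y * z)) = heatMoment h y u := by
    simp only [heatMoment, integral_gaussianReal_eq_integral_smul (one_ne_zero), smul_eq_mul]
    congr 1
    ext z
    ring
  rw [hm] at key
  have h2 : HasDerivAt (fun v : ℝ => (v - u) / y) (1 / y) u :=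
    ((hasDerivAt_id u).sub_const u).div_const y
  have key' : HasDerivAt (fun s => ∫ z, gaussianPDFReal 0 1 (z - s) * h (u + y * z))
      (heatMoment h y u) ((u - u) / y) := by simpa using key
  have h3 := (key'.comp u h2).const_mul y
  have heq : (fun v => y * heatAvg h y v) = fun v =>
      y * ∫ z, gaussianPDFReal 0 1 (z - (v - u) / y) * h (u + y * z) := by
    ext v
    rw [heatAvg_eq_integral, ← integral_sub_right_eq_self _ ((v - u) / y)]
    congr 2
    ext z
    congr 2
    field_simp
    ring
  rw [heq]
  exact h3.congr_deriv (by field_simp)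

lemma mul_heatAvg_deriv (hd : ∀ x, HasDerivAt h (h' x) x) (hc' : Continuous h')
    (hC : ∀ x, |h x| ≤ C) (hC' : ∀ x, |h' x| ≤ C') (y u : ℝ) :
    y * heatAvg h' y u = heatMoment h y u :=
  ((hasDerivAt_heatAvg_space hd hc' hC hC' y u).const_mul y).unique
    (hasDerivAt_mul_heatAvg (continuous_iff_continuousAt.2 fun x => (hd x).continuousAt) hC y u)

end Averages

lemma hasDerivAt_primitive {k : ℝ → ℝ} (hk : Continuous k) (b : ℝ) :
    HasDerivAt (fun x => ∫ y in (0 : ℝ)..x, k y) (k b) b :=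
  (hk.integral_hasStrictDerivAt 0 b).hasDerivAt

lemma hasDerivAt_intervalIntegral_of_continuous {F F' : ℝ → ℝ → ℝ}
    (hF : ∀ x y, HasDerivAt (fun x => F x y) (F' x y) x) (cF : Continuous (Function.uncurry F))
    (cF' : Continuous (Function.uncurry F')) (a b x₀ : ℝ) :
    HasDerivAt (fun x => ∫ y in a..b, F x y) (∫ y in a..b, F' x₀ y) x₀ := by
  obtain ⟨C, hC⟩ := ((isCompact_closedBall x₀ 1).prod (isCompact_uIcc (a := a) (b := b))
    ).exists_bound_of_continuousOn cF'.continuousOn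
  have c1 : ∀ x, Continuous (F x) := fun x => cF.comp (Continuous.prodMk_right x)
  have c2 : ∀ x, Continuous (F' x) := fun x => cF'.comp (Continuous.prodMk_right x)
  refine (intervalIntegral.hasDerivAt_integral_of_dominated_loc_of_deriv_le (bound := fun _ => C)
    (Metric.closedBall_mem_nhds x₀ one_pos)
    (Eventually.of_forall fun x => (c1 x).aestronglyMeasurable)
    ((c1 x₀).intervalIntegrable _ _) (c2 x₀).aestronglyMeasurable
    (Eventually.of_forall fun y hy x hx => ?_) intervalIntegrable_const
    (Eventually.of_forall fun y _ x _ => hF x y)).2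
  exact hC (x, y) ⟨hx, uIoc_subset_uIcc hy⟩

lemma hasDerivAt_comp_of_partial {E E₁ E₂ : ℝ → ℝ → ℝ}
    (h₁ : ∀ a b, HasDerivAt (fun x => E x b) (E₁ a b) a)
    (h₂ : ∀ a b, HasDerivAt (fun x => E a x) (E₂ a b) b)
    (c₁ : Continuous (Function.uncurry E₁)) (c₂ : Continuous (Function.uncurry E₂))
    {α β : ℝ → ℝ} {α' β' t : ℝ} (hα : HasDerivAt α α' t) (hβ : HasDerivAt β β' t) :
    HasDerivAt (fun s => E (α s) (β s)) (E₁ (α t) (β t) * α' + E₂ (α t) (β t) * β') t := by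
  have key := hasStrictFDerivAt_uncurry_coprod (𝕜 := ℝ) (u := (α t, β t)) (f := E)
    (f₁ := fun a b => ContinuousLinearMap.toSpanSingleton ℝ (E₁ a b))
    (f₂ := fun a b => ContinuousLinearMap.toSpanSingleton ℝ (E₂ a b))
    (Eventually.of_forall fun v => (h₁ v.1 v.2).hasFDerivAt)
    (Eventually.of_forall fun v => (h₂ v.1 v.2).hasFDerivAt)
    ((ContinuousLinearMap.toSpanSingletonCLE (𝕜 := ℝ) (E := ℝ)).continuous.comp c₁).continuousAt
    ((ContinuousLinearMap.toSpanSingletonCLE (𝕜 := ℝ) (E := ℝ)).continuous.comp c₂).continuousAt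
  refine (key.hasFDerivAt.comp_hasDerivAt t (hα.prodMk hβ)).congr_deriv ?_
  simp [Function.HasUncurry.uncurry, mul_comm]

section Duhamel

/-- The Duhamel integral `∫₀ᵗ S_{t-s} G(s) ds` of the heat semigroup `S`, written in the scale
variable `y = √(2(t-s))`. -/
noncomputable def duhamel (G : ℝ → ℝ → ℝ) (t u : ℝ) : ℝ :=
  ∫ y in (0 : ℝ)..√(2 * t), y * heatAvg (G (t - y ^ 2 / 2)) y u

/-- The space derivative of the Duhamel integral. -/
noncomputable def duhamelDeriv (G : ℝ → ℝ → ℝ) (t u : ℝ) : ℝ :=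
  ∫ y in (0 : ℝ)..√(2 * t), heatMoment (G (t - y ^ 2 / 2)) y u

variable {G G' : ℝ → ℝ → ℝ} {C C' : ℝ}

lemma continuous_heatAvg (hc : Continuous (Function.uncurry G)) (hC : ∀ t x, |G t x| ≤ C)
    {X : Type*} [TopologicalSpace X] [FirstCountableTopology X] {a b c : X → ℝ}
    (ha : Continuous a) (hb : Continuous b) (hc' : Continuous c) :
    Continuous fun x => heatAvg (G (a x)) (b x) (c x) :=
  continuous_gaussian_integral (k := fun x z => G (a x) (c x + b x * z))
    (hc.comp (by fun_prop : Continuous fun p : X × ℝ => (a p.1, c p.1 + b p.1 * p.2)))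
    (fun _ _ => hC _ _)

lemma continuous_heatMoment (hc : Continuous (Function.uncurry G)) (hC : ∀ t x, |G t x| ≤ C)
    {X : Type*} [TopologicalSpace X] [FirstCountableTopology X] {a b c : X → ℝ}
    (ha : Continuous a) (hb : Continuous b) (hc' : Continuous c) :
    Continuous fun x => heatMoment (G (a x)) (b x) (c x) :=
  continuous_gaussian_moment (k := fun x z => G (a x) (c x + b x * z))
    (hc.comp (by fun_prop : Continuous fun p : X × ℝ => (a p.1, c p.1 + b p.1 * p.2)))
    (fun _ _ => hC _ _)

lemma continuous_slice (hc : Continuous (Function.uncurry G)) (t : ℝ) : Continuous (G t) :=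
  hc.comp (Continuous.prodMk_right t)

lemma continuous_duhamel (hc : Continuous (Function.uncurry G)) (hC : ∀ t x, |G t x| ≤ C) :
    Continuous (Function.uncurry (duhamel G)) := by
  refine intervalIntegral.continuous_parametric_intervalIntegral_of_continuous
    (f := fun (p : ℝ × ℝ) y => y * heatAvg (G (p.1 - y ^ 2 / 2)) y p.2) ?_ (by fun_prop)
  exact continuous_snd.mul (continuous_heatAvg hc hC (by fun_prop) (by fun_prop) (by fun_prop))

lemma continuous_duhamelDeriv (hc : Continuous (Function.uncurry G)) (hC : ∀ t x, |G t x| ≤ C) :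
    Continuous (Function.uncurry (duhamelDeriv G)) := by
  refine intervalIntegral.continuous_parametric_intervalIntegral_of_continuous
    (f := fun (p : ℝ × ℝ) y => heatMoment (G (p.1 - y ^ 2 / 2)) y p.2) ?_ (by fun_prop)
  exact continuous_heatMoment hc hC (by fun_prop) (by fun_prop) (by fun_prop)

lemma abs_duhamel_le (hC : ∀ t x, |G t x| ≤ C) {t τ : ℝ} (ht : t ≤ τ) (hτ : 0 ≤ τ) (u : ℝ) :
    |duhamel G t u| ≤ τ * C := by
  have hC0 : 0 ≤ C := (abs_nonneg _).trans (hC 0 0)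
  have h1 := intervalIntegral.norm_integral_le_of_norm_le (μ := volume)
    (f := fun y => y * heatAvg (G (t - y ^ 2 / 2)) y u) (g := fun y => y * C)
    (Real.sqrt_nonneg (2 * t)) (Eventually.of_forall fun y hy => by
      rw [Real.norm_eq_abs, abs_mul, abs_of_pos hy.1]
      exact mul_le_mul_of_nonneg_left (abs_heatAvg_le (hC _) _ _) hy.1.le)
    ((continuous_id.mul continuous_const).intervalIntegrable _ _)
  refine h1.trans ?_
  rw [intervalIntegral.integral_mul_const, integral_id]
  refine mul_le_mul_of_nonneg_right ?_ hC0
  rcases le_total 0 t with h0 | h0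
  · rw [Real.sq_sqrt (by linarith)]
    linarith
  · rw [Real.sqrt_eq_zero_of_nonpos (by linarith)]
    linarith

lemma abs_duhamelDeriv_le (hC : ∀ t x, |G t x| ≤ C) {t τ : ℝ} (ht : t ≤ τ) (u : ℝ) :
    |duhamelDeriv G t u| ≤ gaussAbsMoment * C * √(2 * τ) := by
  have hC0 : 0 ≤ C := (abs_nonneg _).trans (hC 0 0)
  have h1 := intervalIntegral.norm_integral_le_of_norm_le_const (a := 0) (b := √(2 * t))
    (f := fun y => heatMoment (G (t - y ^ 2 / 2)) y u) (C := gaussAbsMoment * C)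
    (fun y _ => abs_heatMoment_le (hC _) _ _)
  refine h1.trans ?_
  rw [sub_zero, abs_of_nonneg (Real.sqrt_nonneg _)]
  have := gaussAbsMoment_nonneg
  gcongr

lemma duhamel_of_nonpos {t : ℝ} (ht : t ≤ 0) (u : ℝ) : duhamel G t u = 0 := by
  simp [duhamel, Real.sqrt_eq_zero_of_nonpos (by linarith : 2 * t ≤ 0)]

lemma duhamel_sub {K : ℝ → ℝ → ℝ} {D : ℝ} (hc : Continuous (Function.uncurry G))
    (hC : ∀ t x, |G t x| ≤ C) (kc : Continuous (Function.uncurry K)) (kD : ∀ t x, |K t x| ≤ D)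
    (t u : ℝ) :
    duhamel (fun s x => G s x - K s x) t u = duhamel G t u - duhamel K t u := by
  unfold duhamel
  rw [← intervalIntegral.integral_sub]
  · congr 1
    ext y
    rw [heatAvg_sub (continuous_slice hc _) (hC _) (continuous_slice kc _) (kD _), mul_sub]
  · exact (continuous_id.mul (continuous_heatAvg hc hC (by fun_prop) (by fun_prop)
      (by fun_prop))).intervalIntegrable _ _
  · exact (continuous_id.mul (continuous_heatAvg kc kD (by fun_prop) (by fun_prop)
      (by fun_prop))).intervalIntegrable _ _

lemma hasDerivAt_duhamel_space (hc : Continuous (Function.uncurry G)) (hC : ∀ t x, |G t x| ≤ C)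
    (t u : ℝ) : HasDerivAt (fun v => duhamel G t v) (duhamelDeriv G t u) u :=
  hasDerivAt_intervalIntegral_of_continuous
    (F := fun v y => y * heatAvg (G (t - y ^ 2 / 2)) y v)
    (F' := fun v y => heatMoment (G (t - y ^ 2 / 2)) y v)
    (fun v y => hasDerivAt_mul_heatAvg (continuous_slice hc _) (hC _) y v)
    (continuous_snd.mul (continuous_heatAvg hc hC (by fun_prop) (by fun_prop) (by fun_prop)))
    (continuous_heatMoment hc hC (by fun_prop) (by fun_prop) (by fun_prop)) _ _ _

lemma duhamelDeriv_eq_duhamel (hd : ∀ t x, HasDerivAt (G t) (G' t x) x)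
    (hc' : Continuous (Function.uncurry G')) (hC : ∀ t x, |G t x| ≤ C)
    (hC' : ∀ t x, |G' t x| ≤ C') : duhamelDeriv G = duhamel G' := by
  ext t u
  simp only [duhamelDeriv, duhamel,
    mul_heatAvg_deriv (hd _) (continuous_slice hc' _) (hC _) (hC' _)]

lemma hasDerivAt_duhamel_time (hd : ∀ t x, HasDerivAt (G t) (G' t x) x)
    (hc : Continuous (Function.uncurry G)) (hc' : Continuous (Function.uncurry G'))
    (hC : ∀ t x, |G t x| ≤ C) (hC' : ∀ t x, |G' t x| ≤ C') {t : ℝ} (ht : 0 < t) (u : ℝ) :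
    HasDerivAt (fun s => duhamel G s u) (duhamelDeriv G' t u + G t u) t := by
  set N : ℝ → ℝ → ℝ := fun a y => ∫ r in (0 : ℝ)..a, heatAvg (G r) y u with hN
  set R : ℝ → ℝ → ℝ := fun a y => ∫ r in (0 : ℝ)..a, heatMoment (G' r) y u with hR
  have cP : Continuous (Function.uncurry fun y r => heatAvg (G r) y u) :=
    continuous_heatAvg hc hC (by fun_prop) (by fun_prop) (by fun_prop)
  have cQ : Continuous (Function.uncurry fun y r => heatMoment (G' r) y u) :=
    continuous_heatMoment hc' hC' (by fun_prop) (by fun_prop) (by fun_prop)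
  have cR : Continuous (Function.uncurry R) :=
    intervalIntegral.continuous_parametric_intervalIntegral_of_continuous
      (f := fun (p : ℝ × ℝ) r => heatMoment (G' r) p.2 u)
      (continuous_heatMoment hc' hC' (by fun_prop) (by fun_prop) (by fun_prop)) continuous_fst
  have dN1 : ∀ a y, HasDerivAt (fun a => N a y) (heatAvg (G a) y u) a := fun a y =>
    hasDerivAt_primitive (cP.comp (Continuous.prodMk_right y)) a
  have dR1 : ∀ a y, HasDerivAt (fun a => R a y) (heatMoment (G' a) y u) a := fun a y =>
    hasDerivAt_primitive (cQ.comp (Continuous.prodMk_right y)) a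
  have dN2 : ∀ a y, HasDerivAt (fun y => N a y) (R a y) y := fun a y =>
    hasDerivAt_intervalIntegral_of_continuous
      (fun y r => hasDerivAt_heatAvg_scale (hd r) (continuous_slice hc' r) (hC r) (hC' r) y u)
      cP cQ _ _ _
  have dsq : ∀ s y : ℝ, HasDerivAt (fun y : ℝ => s - y ^ 2 / 2) (-y) y := fun s y => by
    refine (((hasDerivAt_pow 2 y).div_const 2).const_sub s).congr_deriv ?_
    simp
  have cRc : ∀ s, Continuous fun y : ℝ => R (s - y ^ 2 / 2) y := fun s =>
    cR.comp (by fun_prop : Continuous fun y : ℝ => (s - y ^ 2 / 2, y))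
  have cPc : ∀ s, Continuous fun y : ℝ => y * heatAvg (G (s - y ^ 2 / 2)) y u := fun s =>
    continuous_id.mul (continuous_heatAvg hc hC (by fun_prop) (by fun_prop) (by fun_prop))
  have hsq : ∀ s, 0 ≤ s → s - √(2 * s) ^ 2 / 2 = 0 := fun s hs => by
    rw [Real.sq_sqrt (by linarith)]
    ring
  have hrep : ∀ s, 0 ≤ s → duhamel G s u =
      (∫ y in (0 : ℝ)..√(2 * s), R (s - y ^ 2 / 2) y) + ∫ r in (0 : ℝ)..s, G r u := by
    intro s hs
    have key : ∀ y ∈ uIcc 0 (√(2 * s)), HasDerivAt (fun y => N (s - y ^ 2 / 2) y)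
        (R (s - y ^ 2 / 2) y - y * heatAvg (G (s - y ^ 2 / 2)) y u) y := fun y _ => by
      refine (hasDerivAt_comp_of_partial dN1 dN2
        (continuous_heatAvg hc hC (by fun_prop) (by fun_prop) (by fun_prop)) cR (dsq s y)
        (hasDerivAt_id y)).congr_deriv ?_
      simp only [id]
      ring
    have := intervalIntegral.integral_eq_sub_of_hasDerivAt key
      (((cRc s).sub (cPc s)).intervalIntegrable _ _)
    rw [intervalIntegral.integral_sub ((cRc s).intervalIntegrable _ _)
      ((cPc s).intervalIntegrable _ _), hsq s hs] at this
    simp only [hN, intervalIntegral.integral_same, ne_eq, OfNat.ofNat_ne_zero, not_false_eq_true,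
      zero_pow, zero_div, sub_zero, heatAvg_zero] at this
    unfold duhamel
    linarith
  have dE1 : ∀ a b, HasDerivAt (fun a => ∫ y in (0 : ℝ)..b, R (a - y ^ 2 / 2) y)
      (∫ y in (0 : ℝ)..b, heatMoment (G' (a - y ^ 2 / 2)) y u) a := fun a b =>
    hasDerivAt_intervalIntegral_of_continuous
      (fun a y => (dR1 (a - y ^ 2 / 2) y).comp_sub_const a (y ^ 2 / 2))
      (cR.comp (by fun_prop : Continuous fun p : ℝ × ℝ => (p.1 - p.2 ^ 2 / 2, p.2)))
      (continuous_heatMoment hc' hC' (by fun_prop) (by fun_prop) (by fun_prop)) _ _ _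
  have dE2 : ∀ a b, HasDerivAt (fun b => ∫ y in (0 : ℝ)..b, R (a - y ^ 2 / 2) y)
      (R (a - b ^ 2 / 2) b) b := fun a b => hasDerivAt_primitive (cRc a) b
  have cE1 : Continuous (Function.uncurry fun a b : ℝ =>
      ∫ y in (0 : ℝ)..b, heatMoment (G' (a - y ^ 2 / 2)) y u) :=
    intervalIntegral.continuous_parametric_intervalIntegral_of_continuous
      (f := fun (p : ℝ × ℝ) y => heatMoment (G' (p.1 - y ^ 2 / 2)) y u)
      (continuous_heatMoment hc' hC' (by fun_prop) (by fun_prop) (by fun_prop)) continuous_snd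
  have cE2 : Continuous (Function.uncurry fun a b : ℝ => R (a - b ^ 2 / 2) b) :=
    cR.comp (by fun_prop : Continuous fun p : ℝ × ℝ => (p.1 - p.2 ^ 2 / 2, p.2))
  have dsqrt : HasDerivAt (fun s : ℝ => √(2 * s)) (2 / (2 * √(2 * t))) t := by
    have := ((hasDerivAt_id t).const_mul 2).sqrt (by simpa using ht.ne')
    simpa using this
  have main := (hasDerivAt_comp_of_partial dE1 dE2 cE1 cE2 (hasDerivAt_id t) dsqrt).add
    (hasDerivAt_primitive
      (hc.comp (Continuous.prodMk_left u) : Continuous fun r => G r u) t)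
  have main' : HasDerivAt (fun s => (∫ y in (0 : ℝ)..√(2 * s), R (s - y ^ 2 / 2) y)
      + ∫ r in (0 : ℝ)..s, G r u) (duhamelDeriv G' t u + G t u) t := by
    refine main.congr_deriv ?_
    simp only [id, hsq t ht.le, hR, intervalIntegral.integral_same, duhamelDeriv,
      Function.comp_apply, Function.uncurry_apply_pair]
    ring
  refine main'.congr_of_eventuallyEq ?_
  filter_upwards [lt_mem_nhds ht] with s hs using hrep s hs.le

lemma hasDerivAt_heatAvg_time {g g' g'' : ℝ → ℝ} (hg : ∀ x, HasDerivAt g (g' x) x)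
    (hg' : ∀ x, HasDerivAt g' (g'' x) x) (hc : Continuous g'') {D D' D'' : ℝ}
    (hD : ∀ x, |g x| ≤ D) (hD' : ∀ x, |g' x| ≤ D') (hD'' : ∀ x, |g'' x| ≤ D'')
    {t : ℝ} (ht : 0 < t) (u : ℝ) :
    HasDerivAt (fun s => heatAvg g (√(2 * s)) u) (heatAvg g'' (√(2 * t)) u) t := by
  have hc' : Continuous g' := continuous_iff_continuousAt.2 fun x => (hg' x).continuousAt
  have hpos : 0 < √(2 * t) := Real.sqrt_pos.2 (by linarith)
  have dsqrt : HasDerivAt (fun s : ℝ => √(2 * s)) (2 / (2 * √(2 * t))) t := by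
    have := ((hasDerivAt_id t).const_mul 2).sqrt (by simpa using ht.ne')
    simpa using this
  refine ((hasDerivAt_heatAvg_scale hg hc' hD hD' (√(2 * t)) u).comp t dsqrt).congr_deriv ?_
  rw [← mul_heatAvg_deriv hg' hc hD' hD'']
  field_simp

end Duhamel

section Existence

open scoped BoundedContinuousFunction

lemma abs_sub_le_of_hasDerivAt {F F' : ℝ → ℝ} (dF : ∀ x, HasDerivAt F (F' x) x) {L : ℝ}
    (hL : ∀ x, |F' x| ≤ L) (a b : ℝ) : |F a - F b| ≤ L * |a - b| :=
  convex_univ.norm_image_sub_le_of_norm_hasDerivWithin_le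
    (fun x _ => (dF x).hasDerivWithinAt) (fun x _ => hL x) (mem_univ b) (mem_univ a)

/-- Existence of classical solutions on a time interval of length controlled by the Lipschitz
constant of the nonlinearity. -/
lemma exists_semilinear_solution {F F' : ℝ → ℝ} (dF : ∀ x, HasDerivAt F (F' x) x)
    (cF' : Continuous F') {L : ℝ} (hL : ∀ x, |F' x| ≤ L) {τ : ℝ} (hτ : 0 < τ)
    (hLτ : τ * L ≤ 1 / 2) {g g' g'' : ℝ → ℝ} (dg : ∀ x, HasDerivAt g (g' x) x)
    (dg' : ∀ x, HasDerivAt g' (g'' x) x) (cg'' : Continuous g'') {D D' D'' : ℝ}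
    (hD : ∀ x, |g x| ≤ D) (hD' : ∀ x, |g' x| ≤ D') (hD'' : ∀ x, |g'' x| ≤ D'')
    (hp : ∀ u, g (u + 1) = g u) :
    ∃ w wu wuu : ℝ → ℝ → ℝ, Continuous (Function.uncurry w) ∧ Continuous (Function.uncurry wuu) ∧
      (∀ t u, w t (u + 1) = w t u) ∧ (∀ u, w 0 u = g u) ∧
      (∀ t u, HasDerivAt (w t) (wu t u) u) ∧ (∀ t u, HasDerivAt (wu t) (wuu t u) u) ∧
      ∀ t ∈ Ioo 0 τ, ∀ u, HasDerivAt (fun s => w s u) (wuu t u + F (w t u)) t := by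
  have cg' : Continuous g' := continuous_iff_continuousAt.2 fun x => (dg' x).continuousAt
  have cg : Continuous g := continuous_iff_continuousAt.2 fun x => (dg x).continuousAt
  have cF : Continuous F := continuous_iff_continuousAt.2 fun x => (dF x).continuousAt
  have hlip := abs_sub_le_of_hasDerivAt dF hL
  have hL0 : 0 ≤ L := (abs_nonneg _).trans (hL 0)
  have cG : ∀ w : ℝ × ℝ →ᵇ ℝ, Continuous (Function.uncurry fun s x => F (w (s, x))) := fun w =>
    cF.comp w.continuous
  have bG : ∀ (w : ℝ × ℝ →ᵇ ℝ) (s x : ℝ), |F (w (s, x))| ≤ |F 0| + L * ‖w‖ := fun w s x => by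
    have h1 := hlip (w (s, x)) 0
    have h2 : |w (s, x)| ≤ ‖w‖ := w.norm_coe_le_norm _
    rw [sub_zero] at h1
    have h3 := abs_sub_abs_le_abs_sub (F (w (s, x))) (F 0)
    nlinarith
  have cavg : ∀ {h : ℝ → ℝ} {C : ℝ}, Continuous h → (∀ x, |h x| ≤ C) →
      Continuous fun p : ℝ × ℝ => heatAvg h (√(2 * p.1)) p.2 := fun hc hC =>
    continuous_heatAvg (G := fun _ => _) (hc.comp continuous_snd) (fun _ => hC)
      (a := fun _ => 0) (by fun_prop) (by fun_prop) (by fun_prop)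
  have cmin : Continuous fun p : ℝ × ℝ => (min p.1 τ, p.2) := by fun_prop
  let Φ : (ℝ × ℝ →ᵇ ℝ) → (ℝ × ℝ →ᵇ ℝ) := fun w =>
    BoundedContinuousFunction.ofNormedAddCommGroup
      (fun p : ℝ × ℝ => heatAvg g (√(2 * p.1)) p.2
        + duhamel (fun s x => F (w (s, x))) (min p.1 τ) p.2)
      ((cavg cg hD).add ((continuous_duhamel (cG w) (bG w)).comp cmin))
      (D + τ * (|F 0| + L * ‖w‖))
      (fun p => (abs_add_le _ _).trans (add_le_add (abs_heatAvg_le hD _ _)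
        (abs_duhamel_le (bG w) (min_le_right _ _) hτ.le _)))
  have hΦ : ∀ w p, Φ w p = heatAvg g (√(2 * p.1)) p.2
        + duhamel (fun s x => F (w (s, x))) (min p.1 τ) p.2 := fun w p => rfl
  have hcontr : ContractingWith (1 / 2) Φ := by
    refine ⟨by norm_num, LipschitzWith.of_dist_le_mul fun v w => ?_⟩
    have hK : ((1 / 2 : NNReal) : ℝ) = 1 / 2 := by norm_num
    rw [hK]
    refine (BoundedContinuousFunction.dist_le (by positivity)).2 fun p => ?_
    rw [hΦ, hΦ, Real.dist_eq, add_sub_add_left_eq_sub,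
      ← duhamel_sub (cG v) (bG v) (cG w) (bG w)]
    refine (abs_duhamel_le (C := L * dist v w) (fun s x => (hlip _ _).trans ?_)
      (min_le_right _ _) hτ.le _).trans ?_
    · exact mul_le_mul_of_nonneg_left
        (by simpa [Real.dist_eq] using
          BoundedContinuousFunction.dist_coe_le_dist (f := v) (g := w) (s, x)) hL0
    · nlinarith [dist_nonneg (x := v) (y := w)]
  set W : ℝ × ℝ →ᵇ ℝ := ContractingWith.fixedPoint Φ hcontr with hW
  have hfix : Φ W = W := hcontr.fixedPoint_isFixedPt
  have hWeq : ∀ t u, W (t, u) = heatAvg g (√(2 * t)) u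
      + duhamel (fun s x => F (W (s, x))) (min t τ) u := fun t u => by
    rw [← hΦ W (t, u), hfix]
  have hper : ∀ t u, W (t, u + 1) = W (t, u) := by
    let V : ℝ × ℝ →ᵇ ℝ := W.compContinuous ⟨fun p => (p.1, p.2 + 1), by fun_prop⟩
    have hV : Φ V = V := by
      ext ⟨t, u⟩
      rw [hΦ]
      change _ = W (t, u + 1)
      rw [hWeq, heatAvg_add_one hp]
      congr 1
      simp only [duhamel, heatAvg]
      congr 1
      ext y
      congr 2
      ext z
      change F (W (_, _)) = _
      ring_nf
    have hVW : V = W := hcontr.fixedPoint_unique hV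
    intro t u
    exact congrArg (fun f : ℝ × ℝ →ᵇ ℝ => f (t, u)) hVW
  set G : ℝ → ℝ → ℝ := fun s x => F (W (s, x)) with hG
  set wu : ℝ → ℝ → ℝ := fun t u => heatAvg g' (√(2 * t)) u + duhamelDeriv G (min t τ) u with hwu
  have dW : ∀ t u, HasDerivAt (fun v => W (t, v)) (wu t u) u := fun t u => by
    simp only [hWeq]
    exact (hasDerivAt_heatAvg_space dg cg' hD hD' _ _).add
      (hasDerivAt_duhamel_space (cG W) (bG W) _ _)
  have cwu : Continuous (Function.uncurry wu) :=
    (cavg cg' hD').add ((continuous_duhamelDeriv (cG W) (bG W)).comp cmin)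
  obtain ⟨B, hB⟩ : ∃ B, ∀ t u, |wu t u| ≤ B :=
    ⟨_, fun t u => (abs_add_le _ _).trans (add_le_add (abs_heatAvg_le hD' _ _)
      (abs_duhamelDeriv_le (bG W) (min_le_right _ _) _))⟩
  set G' : ℝ → ℝ → ℝ := fun s x => F' (W (s, x)) * wu s x with hG'
  have dG : ∀ t x, HasDerivAt (G t) (G' t x) x := fun t x => (dF _).comp x (dW t x)
  have cG' : Continuous (Function.uncurry G') := (cF'.comp W.continuous).mul cwu
  have bG' : ∀ t x, |G' t x| ≤ L * B := fun t x => by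
    rw [abs_mul]
    exact mul_le_mul (hL _) (hB _ _) (abs_nonneg _) hL0
  refine ⟨fun t u => W (t, u), wu,
    fun t u => heatAvg g'' (√(2 * t)) u + duhamelDeriv G' (min t τ) u, W.continuous,
    (cavg cg'' hD'').add ((continuous_duhamelDeriv cG' bG').comp cmin), hper, fun u => ?_, dW,
    fun t u => ?_, fun t ht u => ?_⟩
  · simp only [hWeq, min_eq_left hτ.le, duhamel_of_nonpos le_rfl, mul_zero, Real.sqrt_zero,
      heatAvg_zero, add_zero]
  · simp only [hwu, duhamelDeriv_eq_duhamel dG cG' (bG W) bG']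
    exact (hasDerivAt_heatAvg_space dg' cg'' hD' hD'' _ _).add
      (hasDerivAt_duhamel_space cG' bG' _ _)
  · have h1 := (hasDerivAt_heatAvg_time dg dg' cg'' hD hD' hD'' ht.1 u).add
      (hasDerivAt_duhamel_time dG (cG W) cG' (bG W) bG' ht.1 u)
    refine (h1.congr_of_eventuallyEq ?_).congr_deriv ?_
    · filter_upwards [gt_mem_nhds ht.2] with s hs
      rw [hWeq, min_eq_left hs.le]
      rfl
    · simp only [min_eq_left ht.2.le, add_assoc, hG]

end Existence

section MaximumPrinciple

lemma deriv_deriv_nonpos_of_isMax {h : ℝ → ℝ} {x : ℝ} (hmax : ∀ y, h y ≤ h x)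
    (hd : DifferentiableAt ℝ h x) : deriv (deriv h) x ≤ 0 := by
  by_contra! hpos
  have hloc : IsLocalMax h x := Eventually.of_forall hmax
  have hmin := isLocalMin_of_deriv_deriv_pos hpos hloc.deriv_eq_zero hd.continuousAt
  have hconst : h =ᶠ[𝓝 x] fun _ => h x := by
    filter_upwards [hmin] with y hy using le_antisymm (hmax y) hy
  have h2 : deriv (deriv h) x = 0 := by
    rw [hconst.deriv.deriv_eq]
    simp
  exact hpos.ne' h2

lemma deriv_nonneg_of_le_left {h : ℝ → ℝ} {h' a x : ℝ} (hax : a < x)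
    (hmax : ∀ y ∈ Icc a x, h y ≤ h x) (hd : HasDerivAt h h' x) : 0 ≤ h' := by
  refine ge_of_tendsto
    ((hasDerivWithinAt_iff_tendsto_slope' self_notMem_Iio).1 (hd.hasDerivWithinAt (s := Iio x))) ?_
  filter_upwards [Ioo_mem_nhdsLT hax] with y hy
  rw [slope_def_field]
  exact div_nonneg_of_nonpos (by linarith [hmax y ⟨hy.1.le, hy.2.le⟩]) (by linarith [hy.2])

lemma map_fract_of_periodic {h : ℝ → ℝ} (hp : ∀ u, h (u + 1) = h u) (u : ℝ) :
    h (Int.fract u) = h u := by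
  have hper : Function.Periodic h 1 := hp
  have := hper.sub_zsmul_eq (x := u) ⌊u⌋
  rwa [zsmul_one, Int.self_sub_floor] at this

lemma nonpos_of_parabolic_inequality {d : ℝ → ℝ → ℝ} {δ L : ℝ}
    (hc : ContinuousOn (fun p : ℝ × ℝ => d p.1 p.2) (Ico 0 δ ×ˢ univ))
    (hp : ∀ t ∈ Ico 0 δ, ∀ u, d t (u + 1) = d t u) (h0 : ∀ u, d 0 u ≤ 0)
    (ht : ∀ t ∈ Ioo 0 δ, ∀ u, DifferentiableAt ℝ (fun s => d s u) t)
    (hu : ∀ t ∈ Ioo 0 δ, ∀ u, DifferentiableAt ℝ (d t) u)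
    (hle : ∀ t ∈ Ioo 0 δ, ∀ u, deriv (fun s => d s u) t ≤ deriv (deriv (d t)) u + L * |d t u|) :
    ∀ t ∈ Ico 0 δ, ∀ u, d t u ≤ 0 := by
  intro t₁ ht₁ u₁
  by_contra! hpos
  set K := L + 1
  have hsub : Icc 0 t₁ ×ˢ Icc (0 : ℝ) 1 ⊆ Ico 0 δ ×ˢ univ := fun p hp =>
    ⟨⟨hp.1.1, hp.1.2.trans_lt ht₁.2⟩, mem_univ _⟩
  have hfract : ∀ t ∈ Ico 0 δ, ∀ u, d t (Int.fract u) = d t u := fun t ht u =>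
    map_fract_of_periodic (hp t ht) u
  have hfm : ∀ u : ℝ, Int.fract u ∈ Icc (0 : ℝ) 1 := fun u =>
    ⟨Int.fract_nonneg u, (Int.fract_lt_one u).le⟩
  obtain ⟨⟨t, u⟩, htu, hmax⟩ := (isCompact_Icc.prod isCompact_Icc).exists_isMaxOn
    ⟨(0, 0), ⟨⟨le_rfl, ht₁.1⟩, ⟨le_rfl, zero_le_one⟩⟩⟩
    (((by fun_prop : Continuous fun p : ℝ × ℝ => Real.exp (-K * p.1)).continuousOn.mul
      (hc.mono hsub)))
  have hm : ∀ s ∈ Icc 0 t₁, ∀ v, Real.exp (-K * s) * d s v ≤ Real.exp (-K * t) * d t u :=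
    fun s hs v => by
      rw [← hfract s ⟨hs.1, hs.2.trans_lt ht₁.2⟩ v]
      exact hmax (⟨hs, hfm v⟩ : (s, Int.fract v) ∈ Icc 0 t₁ ×ˢ Icc (0 : ℝ) 1)
  have hdpos : 0 < d t u := by
    have h1 := hm t₁ ⟨ht₁.1, le_rfl⟩ u₁
    have h2 : 0 < Real.exp (-K * t₁) * d t₁ u₁ := by positivity
    exact pos_of_mul_pos_right (h2.trans_le h1) (Real.exp_pos _).le
  have ht0 : 0 < t := htu.1.1.lt_of_ne fun h => by
    change 0 = t at h
    subst h
    exact absurd (h0 u) hdpos.not_ge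
  have hti : t ∈ Ioo 0 δ := ⟨ht0, htu.1.2.trans_lt ht₁.2⟩
  have hspace : deriv (deriv (d t)) u ≤ 0 := by
    refine deriv_deriv_nonpos_of_isMax (fun v => ?_) (hu t hti u)
    exact le_of_mul_le_mul_left (hm t htu.1 v) (Real.exp_pos _)
  have hexp : HasDerivAt (fun s => Real.exp (-K * s)) (Real.exp (-K * t) * -K) t := by
    simpa using ((hasDerivAt_id t).const_mul (-K)).exp
  have htime := deriv_nonneg_of_le_left ht0
    (h := fun s => Real.exp (-K * s) * d s u)
    (fun s hs => hm s ⟨hs.1, hs.2.trans htu.1.2⟩ u) (hexp.mul (ht t hti u).hasDerivAt)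
  have hle' := hle t hti u
  rw [abs_of_pos hdpos] at hle'
  have : 0 ≤ Real.exp (-K * t) * (deriv (fun s => d s u) t - K * d t u) := by linarith
  have := nonneg_of_mul_nonneg_right this (Real.exp_pos _)
  simp only [K] at this
  linarith

lemma eq_zero_of_parabolic_inequality {d : ℝ → ℝ → ℝ} {δ L : ℝ}
    (hc : ContinuousOn (fun p : ℝ × ℝ => d p.1 p.2) (Ico 0 δ ×ˢ univ))
    (hp : ∀ t ∈ Ico 0 δ, ∀ u, d t (u + 1) = d t u) (h0 : ∀ u, d 0 u = 0)
    (ht : ∀ t ∈ Ioo 0 δ, ∀ u, DifferentiableAt ℝ (fun s => d s u) t)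
    (hu : ∀ t ∈ Ioo 0 δ, ∀ u, DifferentiableAt ℝ (d t) u)
    (hle : ∀ t ∈ Ioo 0 δ, ∀ u,
      |deriv (fun s => d s u) t - deriv (deriv (d t)) u| ≤ L * |d t u|) :
    ∀ t ∈ Ico 0 δ, ∀ u, d t u = 0 := by
  intro t htδ u
  refine le_antisymm (nonpos_of_parabolic_inequality (L := L) hc hp (fun u => (h0 u).le) ht hu
    (fun t ht u => ?_) t htδ u) ?_
  · linarith [(abs_le.1 (hle t ht u)).2]
  · have := nonpos_of_parabolic_inequality (d := fun t u => -d t u) (L := L) hc.neg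
      (fun t ht u => by simp [hp t ht u]) (fun u => by simp [h0])
      (fun t htt u => (ht t htt u).neg) (fun t htt u => (hu t htt u).neg) (fun t htt u => ?_) t htδ u
    · simpa using this
    · have h1 : deriv (fun v => -d t v) = fun v => -deriv (d t) v := by
        ext v
        exact deriv.fun_neg
      rw [h1, deriv.fun_neg, deriv.fun_neg, abs_neg]
      linarith [(abs_le.1 (hle t htt u)).1]

end MaximumPrinciple

/-- A `C¹` function agrees on a given ball with a `C¹` function of bounded derivative. -/
lemma exists_truncation {f : ℝ → ℝ} (hf : ContDiff ℝ 1 f) (R : ℝ) :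
    ∃ (F F' : ℝ → ℝ) (L : ℝ), (∀ x, HasDerivAt F (F' x) x) ∧ Continuous F' ∧
      (∀ x, |F' x| ≤ L) ∧ ∀ x, |x| ≤ R → F x = f x := by
  have hf' : Continuous (deriv f) := hf.continuous_deriv le_rfl
  have hcont : Continuous fun x => deriv f (max (-R) (min R x)) := hf'.comp (by fun_prop)
  obtain ⟨L, hL⟩ := (isCompact_Icc (a := -|R|) (b := |R|)).exists_bound_of_continuousOn
    hf'.continuousOn
  refine ⟨fun x => f 0 + ∫ s in (0 : ℝ)..x, deriv f (max (-R) (min R s)),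
    fun x => deriv f (max (-R) (min R x)), L, fun x => ?_, hcont, fun x => hL _ ⟨?_, ?_⟩,
    fun x hx => ?_⟩
  · exact (hasDerivAt_primitive hcont x).const_add _
  · exact (neg_le_neg (le_abs_self R)).trans (le_max_left _ _)
  · exact max_le (neg_le_abs R) ((min_le_left _ _).trans (le_abs_self R))
  · have h1 : ∫ s in (0 : ℝ)..x, deriv f (max (-R) (min R s)) = ∫ s in (0 : ℝ)..x, deriv f s := by
      refine intervalIntegral.integral_congr fun s hs => ?_
      have h2 : |s| ≤ |x| := by simpa using abs_sub_left_of_mem_uIcc hs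
      have h3 := abs_le.1 (h2.trans hx)
      simp only [min_eq_right h3.2, max_eq_right h3.1]
    beta_reduce
    rw [h1, intervalIntegral.integral_deriv_eq_sub
      (fun y _ => hf.differentiable one_ne_zero y) (hf'.intervalIntegrable _ _)]
    ring

lemma exists_bound_of_periodic {h : ℝ → ℝ} (hc : Continuous h) (hp : ∀ u, h (u + 1) = h u) :
    ∃ C, ∀ x, |h x| ≤ C := by
  obtain ⟨C, hC⟩ := (Function.Periodic.isBounded_of_continuous (f := h) (c := 1) hp one_ne_zero
    hc).exists_norm_le
  exact ⟨C, fun x => hC _ (mem_range_self x)⟩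

lemma deriv_add_one_of_periodic {h : ℝ → ℝ} (hp : ∀ u, h (u + 1) = h u) (u : ℝ) :
    deriv h (u + 1) = deriv h u := by
  rw [← deriv_comp_add_const]
  simp only [hp]

lemma continuousOn_of_split {H H₁ H₂ : ℝ × ℝ → ℝ} {A : Set (ℝ × ℝ)} {t₀ T T' : ℝ} (ht₀ : t₀ < T)
    (h₁ : ContinuousOn H₁ (A ∩ {p | p.1 < T})) (e₁ : ∀ p : ℝ × ℝ, p.1 < T → H p = H₁ p)
    (h₂ : Continuous H₂) (e₂ : ∀ p : ℝ × ℝ, t₀ < p.1 → p.1 < T' → H p = H₂ p) :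
    ContinuousOn H (A ∩ {p | p.1 < T'}) := by
  intro p hp
  have hlt : ∀ {c : ℝ}, p.1 < c → ∀ᶠ q in 𝓝 p, q.1 < c := fun h =>
    continuous_fst.continuousAt.eventually (gt_mem_nhds h)
  rcases lt_or_ge p.1 T with hpT | hpT
  · refine ((h₁ p ⟨hp.1, hpT⟩).mono_of_mem_nhdsWithin ?_).congr_of_eventuallyEq ?_ (e₁ p hpT)
    · filter_upwards [self_mem_nhdsWithin, mem_nhdsWithin_of_mem_nhds (hlt hpT)] with q hq hqT
        using ⟨hq.1, hqT⟩
    · filter_upwards [mem_nhdsWithin_of_mem_nhds (hlt hpT)] with q hq using e₁ q hq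
  · have hgt : ∀ᶠ q in 𝓝 p, t₀ < q.1 :=
      continuous_fst.continuousAt.eventually (lt_mem_nhds (ht₀.trans_le hpT))
    refine ContinuousAt.continuousWithinAt (h₂.continuousAt.congr ?_)
    filter_upwards [hgt, hlt hp.2] with q h1 h2 using (e₂ q h1 h2).symm

/-- A classical solution on `[0,T)` that agrees on `[t₀,T)` with a solution `w` started at time
`t₀` and living past `T` is continued by `w`. -/
lemma IsSemilinearHeatSolutionIco.glue {T t₀ δ : ℝ} {f φ : ℝ → ℝ} {ρ w wu wuu : ℝ → ℝ → ℝ}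
    (hρ : IsSemilinearHeatSolutionIco T f φ ρ) (hf : Continuous f) (ht₀ : 0 < t₀) (ht₀T : t₀ < T)
    (cw : Continuous (Function.uncurry w)) (cwuu : Continuous (Function.uncurry wuu))
    (hp : ∀ t u, w t (u + 1) = w t u) (hwu : ∀ t u, HasDerivAt (w t) (wu t u) u)
    (hwuu : ∀ t u, HasDerivAt (wu t) (wuu t u) u)
    (hwt : ∀ t ∈ Ioo 0 δ, ∀ u, HasDerivAt (fun s => w s u) (wuu t u + f (w t u)) t)
    (heq : ∀ t ∈ Ico t₀ T, ∀ u, ρ t u = w (t - t₀) u) :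
    ∃ ρ' : ℝ → ℝ → ℝ, IsSemilinearHeatSolutionIco (t₀ + δ) f φ ρ' ∧
      ∀ t ∈ Ico (0 : ℝ) T, ∀ u : ℝ, ρ' t u = ρ t u := by
  obtain ⟨hρc, hρp, hρ0, hρd, hρt, hρuu⟩ := hρ
  set ρ' : ℝ → ℝ → ℝ := fun t u => if t < T then ρ t u else w (t - t₀) u with hρ'
  have hA : ∀ t, t < T → ρ' t = ρ t := fun t ht => by
    ext u
    simp [hρ', ht]
  have hB : ∀ t, t₀ ≤ t → ρ' t = w (t - t₀) := fun t ht => by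
    ext u
    by_cases h : t < T
    · rw [hA t h, heq t ⟨ht, h⟩]
    · simp [hρ', h]
  have hAt : ∀ t, t < T → ∀ u, (fun s => ρ' s u) =ᶠ[𝓝 t] fun s => ρ s u := fun t ht u => by
    filter_upwards [gt_mem_nhds ht] with s hs
    rw [hA s hs]
  have hBt : ∀ t, t₀ < t → t < t₀ + δ → ∀ u,
      HasDerivAt (fun s => ρ' s u) (wuu (t - t₀) u + f (w (t - t₀) u)) t := fun t h1 h2 u => by
    refine ((hwt (t - t₀) ⟨by linarith, by linarith⟩ u).comp_sub_const t t₀).congr_of_eventuallyEq ?_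
    filter_upwards [lt_mem_nhds h1] with s hs
    rw [hB s hs.le]
  have hwu' : ∀ t, deriv (w t) = wu t := fun t => funext fun u => (hwu t u).deriv
  have hwuu' : ∀ t u, deriv (wu t) u = wuu t u := fun t u => (hwuu t u).deriv
  have hshift : Continuous fun p : ℝ × ℝ => (p.1 - t₀, p.2) := by fun_prop
  have hIco : ∀ c : ℝ, Ico 0 c ×ˢ (univ : Set ℝ) = (Ici 0 ×ˢ univ) ∩ {p | p.1 < c} := fun c => by
    ext p
    simp
  have hIoo : ∀ c : ℝ, Ioo 0 c ×ˢ (univ : Set ℝ) = (Ioi 0 ×ˢ univ) ∩ {p | p.1 < c} := fun c => by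
    ext p
    simp
  refine ⟨ρ', ⟨?_, fun t ht u => ?_, fun u => ?_, fun t ht u => ?_, ?_, ?_⟩,
    fun t ht u => by rw [hA t ht.2]⟩
  · rw [hIco] at hρc ⊢
    exact continuousOn_of_split ht₀T hρc (fun p hp => by rw [hA _ hp]) (cw.comp hshift)
      (fun p hp _ => by rw [hB _ hp.le]; rfl)
  · rcases lt_or_ge t T with h | h
    · rw [hA t h, hρp t ⟨ht.1, h⟩]
    · rw [hB t (ht₀T.le.trans h), hp]
  · rw [hA 0 (ht₀.trans ht₀T), hρ0]
  · rcases lt_or_ge t T with h | h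
    · rw [hA t h, (hAt t h u).deriv_eq]
      obtain ⟨h1, h2⟩ := hρd t ⟨ht.1, h⟩ u
      exact ⟨h1.congr_of_eventuallyEq (hAt t h u), h2⟩
    · have hlt := ht₀T.trans_le h
      have hd := hBt t hlt ht.2 u
      refine ⟨hd.differentiableAt, ?_⟩
      rw [hd.deriv, hB t hlt.le, hwu', hwuu']
      exact ⟨(hwu _ u).differentiableAt, (hwuu _ u).differentiableAt, rfl⟩
  · rw [hIoo] at hρt ⊢
    exact continuousOn_of_split ht₀T hρt (fun p hp => (hAt p.1 hp p.2).deriv_eq)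
      ((cwuu.add (hf.comp cw)).comp hshift) (fun p h1 h2 => (hBt p.1 h1 h2 p.2).deriv)
  · rw [hIoo] at hρuu ⊢
    exact continuousOn_of_split ht₀T hρuu (fun p hp => by rw [hA _ hp]) (cwuu.comp hshift)
      (fun p hp _ => by rw [hB _ hp.le, hwu', hwuu']; rfl)

/-- Uniqueness: a bounded classical solution agrees with a solution of the truncated equation
issued from its value at time `t₀`. -/
lemma IsSemilinearHeatSolutionIco.eq_of_truncation {T t₀ τ R L : ℝ} {f φ F F' : ℝ → ℝ}
    {ρ w wu wuu : ℝ → ℝ → ℝ} (hρ : IsSemilinearHeatSolutionIco T f φ ρ)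
    (hR : ∀ t ∈ Ico 0 T, ∀ u, |ρ t u| ≤ R) (dF : ∀ x, HasDerivAt F (F' x) x)
    (hL : ∀ x, |F' x| ≤ L) (hF : ∀ x, |x| ≤ R → F x = f x) (ht₀ : 0 < t₀) (hτ : T ≤ t₀ + τ)
    (cw : Continuous (Function.uncurry w)) (hp : ∀ t u, w t (u + 1) = w t u)
    (hw0 : ∀ u, w 0 u = ρ t₀ u) (hwu : ∀ t u, HasDerivAt (w t) (wu t u) u)
    (hwuu : ∀ t u, HasDerivAt (wu t) (wuu t u) u)
    (hwt : ∀ t ∈ Ioo 0 τ, ∀ u, HasDerivAt (fun s => w s u) (wuu t u + F (w t u)) t) :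
    ∀ t ∈ Ico t₀ T, ∀ u, ρ t u = w (t - t₀) u := by
  obtain ⟨hρc, hρp, -, hρd, -, -⟩ := hρ
  have hmem : ∀ t ∈ Ico 0 (T - t₀), t₀ + t ∈ Ico 0 T := fun t ht =>
    ⟨by linarith [ht.1], by linarith [ht.2]⟩
  have hmem' : ∀ t ∈ Ioo 0 (T - t₀), t₀ + t ∈ Ioo 0 T := fun t ht =>
    ⟨by linarith [ht.1], by linarith [ht.2]⟩
  have ht : ∀ t ∈ Ioo 0 (T - t₀), ∀ u, HasDerivAt (fun s => w s u - ρ (t₀ + s) u)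
      (wuu t u + F (w t u) - (deriv (deriv (ρ (t₀ + t))) u + F (ρ (t₀ + t) u))) t := by
    intro t ht u
    obtain ⟨h1, -, -, h2⟩ := hρd _ (hmem' t ht) u
    rw [hF _ (hR _ (hmem t ⟨ht.1.le, ht.2⟩) u), ← h2]
    exact (hwt t ⟨ht.1, by linarith [ht.2]⟩ u).sub (h1.hasDerivAt.comp_const_add t₀ t)
  have hu : ∀ t ∈ Ioo 0 (T - t₀), ∀ u, HasDerivAt (fun v => w t v - ρ (t₀ + t) v)
      (wu t u - deriv (ρ (t₀ + t)) u) u := fun t ht u =>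
    (hwu t u).sub (hρd _ (hmem' t ht) u).2.1.hasDerivAt
  have key := eq_zero_of_parabolic_inequality (d := fun t u => w t u - ρ (t₀ + t) u)
    (δ := T - t₀) (L := L) (cw.continuousOn.sub (hρc.comp
      (by fun_prop : Continuous fun p : ℝ × ℝ => (t₀ + p.1, p.2)).continuousOn
      (fun p hp => ⟨hmem _ hp.1, mem_univ _⟩)))
    (fun t ht u => by simp only [hp, hρp _ (hmem t ht)]) (fun u => by simp [hw0])
    (fun t htt u => (ht t htt u).differentiableAt) (fun t htt u => (hu t htt u).differentiableAt)
    (fun t htt u => ?_)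
  · intro t htt u
    have := key (t - t₀) ⟨by linarith [htt.1], by linarith [htt.2]⟩ u
    simp only [add_sub_cancel] at this
    linarith
  · have h1 : deriv (fun v => w t v - ρ (t₀ + t) v) = fun v => wu t v - deriv (ρ (t₀ + t)) v :=
      funext fun v => (hu t htt v).deriv
    have h2 := ((hwuu t u).sub (hρd _ (hmem' t htt) u).2.2.1.hasDerivAt).deriv
    have h3 : deriv (fun v => wu t v - deriv (ρ (t₀ + t)) v) u =
      wuu t u - deriv (deriv (ρ (t₀ + t))) u := h2
    rw [(ht t htt u).deriv, h1, h3]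
    refine le_trans (le_of_eq ?_) (abs_sub_le_of_hasDerivAt dF hL (w t u) (ρ (t₀ + t) u))
    congr 1
    ring

/-- A function that is bounded by `M` before time `δ` stays below any larger bound for a
short while. -/
lemma exists_bound_past {w : ℝ → ℝ → ℝ} (cw : Continuous (Function.uncurry w))
    (hp : ∀ t u, w t (u + 1) = w t u) {δ τ M R : ℝ} (hδ : 0 < δ) (hδτ : δ < τ) (hMR : M < R)
    (hM : ∀ t ∈ Ico 0 δ, ∀ u, |w t u| ≤ M) :
    ∃ δ', δ < δ' ∧ δ' ≤ τ ∧ ∀ t ∈ Ico 0 δ', ∀ u, |w t u| ≤ R := by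
  have hend : ∀ u, |w δ u| ≤ M := fun u => by
    have hc : Continuous fun s => |w s u| := (cw.comp (Continuous.prodMk_left u)).abs
    refine le_of_tendsto (x := 𝓝[<] δ) (hc.continuousAt.mono_left nhdsWithin_le_nhds) ?_
    filter_upwards [Ioo_mem_nhdsLT hδ] with s hs using hM s ⟨hs.1.le, hs.2⟩ u
  have hev : ∀ᶠ s in 𝓝 δ, ∀ u ∈ Icc (0 : ℝ) 1, |w s u| < R :=
    isCompact_Icc.eventually_forall_of_forall_eventually fun u _ =>
      (cw.abs.continuousAt (x := (δ, u))).eventually (gt_mem_nhds ((hend u).trans_lt hMR))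
  obtain ⟨ε, hε, hball⟩ := Metric.eventually_nhds_iff.1 hev
  refine ⟨min (δ + ε) τ, lt_min (by linarith) hδτ, min_le_right _ _, fun t ht u => ?_⟩
  rcases lt_or_ge t δ with h | h
  · exact (hM t ⟨ht.1, h⟩ u).trans hMR.le
  · rw [← map_fract_of_periodic (hp t) u]
    refine (hball ?_ _ ⟨Int.fract_nonneg u, (Int.fract_lt_one u).le⟩).le
    rw [Real.dist_eq, abs_of_nonneg (by linarith)]
    linarith [ht.2.trans_le (min_le_left _ _)]

/-- Continuation criterion for the semilinear heat equation on the torus: a classical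
solution on `[0,T)`, `T < ∞`, whose sup-norm stays bounded up to time `T` can be
extended to a classical solution on a strictly larger interval `[0,T')`. -/
theorem semilinear_heat_continuation
    (f : ℝ → ℝ) (hf : ContDiff ℝ 1 f)
    (φ : ℝ → ℝ) (hφc : Continuous φ) (hφper : ∀ u : ℝ, φ (u + 1) = φ u)
    (T : ℝ) (hT : 0 < T)
    (ρ : ℝ → ℝ → ℝ) (hρ : IsSemilinearHeatSolutionIco T f φ ρ)
    (hbound : ∃ M : ℝ, ∀ t ∈ Set.Ico (0:ℝ) T, ∀ u : ℝ, |ρ t u| ≤ M) :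
    ∃ T' : ℝ, T < T' ∧
      ∃ ρ' : ℝ → ℝ → ℝ, IsSemilinearHeatSolutionIco T' f φ ρ' ∧
        ∀ t ∈ Set.Ico (0:ℝ) T, ∀ u : ℝ, ρ' t u = ρ t u := by

  obtain ⟨M, hM⟩ := hbound
  obtain ⟨F, F', L, dF, cF', hL, hF⟩ := exists_truncation hf (M + 1)
  have hL0 : 0 ≤ L := (abs_nonneg _).trans (hL 0)
  set τ : ℝ := 1 / (2 * (L + 1)) with hτdef
  have hτ : 0 < τ := by positivity
  have hLτ : τ * L ≤ 1 / 2 := by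
    rw [hτdef, div_mul_eq_mul_div, div_le_div_iff₀ (by positivity) (by positivity)]
    linarith
  set δ : ℝ := min τ T / 2 with hδdef
  have hδ : 0 < δ := half_pos (lt_min hτ hT)
  have hδτ : δ < τ := (half_lt_self (lt_min hτ hT)).trans_le (min_le_left _ _)
  have hδT : δ < T := (half_lt_self (lt_min hτ hT)).trans_le (min_le_right _ _)
  set t₀ : ℝ := T - δ with ht₀def
  have ht₀ : 0 < t₀ := sub_pos.2 hδT
  have ht₀T : t₀ < T := sub_lt_self _ hδ
  obtain ⟨-, hρp, -, hρd, -, hρuu⟩ := id hρ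
  have hmem : t₀ ∈ Ioo 0 T := ⟨ht₀, ht₀T⟩
  have hp := hρp t₀ ⟨ht₀.le, ht₀T⟩
  have dg : ∀ x, HasDerivAt (ρ t₀) (deriv (ρ t₀) x) x := fun x => (hρd t₀ hmem x).2.1.hasDerivAt
  have dg' : ∀ x, HasDerivAt (deriv (ρ t₀)) (deriv (deriv (ρ t₀)) x) x := fun x =>
    (hρd t₀ hmem x).2.2.1.hasDerivAt
  have cg' : Continuous (deriv (ρ t₀)) := continuous_iff_continuousAt.2 fun x =>
    (dg' x).continuousAt
  have cg'' : Continuous (deriv (deriv (ρ t₀))) :=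
    hρuu.comp_continuous (Continuous.prodMk_right t₀) fun x => ⟨hmem, mem_univ _⟩
  have hp' := deriv_add_one_of_periodic hp
  obtain ⟨D', hD'⟩ := exists_bound_of_periodic cg' hp'
  obtain ⟨D'', hD''⟩ := exists_bound_of_periodic cg'' (deriv_add_one_of_periodic hp')
  obtain ⟨w, wu, wuu, cw, cwuu, hwp, hw0, hwu, hwuu, hwt⟩ :=
    exists_semilinear_solution dF cF' hL hτ hLτ dg dg' cg'' (hM t₀ ⟨ht₀.le, ht₀T⟩) hD' hD'' hp
  have heq := hρ.eq_of_truncation (fun t ht u => (hM t ht u).trans (by linarith)) dF hL hF ht₀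
    (by linarith) cw hwp hw0 hwu hwuu hwt
  obtain ⟨δ', hδδ', hδ'τ, hwR⟩ := exists_bound_past cw hwp hδ hδτ (lt_add_one M)
    (fun t ht u => by
      have hm : t₀ + t ∈ Ico t₀ T := ⟨by linarith [ht.1], by linarith [ht.2]⟩
      have h1 := heq _ hm u
      rw [add_sub_cancel_left] at h1
      rw [← h1]
      exact hM _ ⟨ht₀.le.trans hm.1, hm.2⟩ u)
  refine ⟨t₀ + δ', by linarith, hρ.glue hf.continuous ht₀ ht₀T cw cwuu hwp hwu hwuu
    (fun t ht u => ?_) heq⟩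
  rw [← hF _ (hwR t ⟨ht.1.le, ht.2⟩ u)]
  exact hwt t ⟨ht.1, ht.2.trans_le hδ'τ⟩ u
end
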